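/- (Corollary 6 of the paper: alternative performance-loss bound for the reward-adjusted solution.) Assume Assumption 1 holds and define the adjusted reward r̂ x a = r x a − (γ·Rmax/(1−γ)) · e x a. Let T̂ be the optimal Bellman operator of the reward-adjusted simulated MDP, (T̂ V) x = max_a ( r̂ x a + γ · ∑_{x'} P̂ x a x' · V x' ). Let π0 be a policy maximizing ρ(·, P̂, r̂) over all policies, with value function V̂^{π0} = (1 − γ·P̂_{π0})⁻¹ ⬝ r̂_{π0}, and Bellman residual BR(π0) = max_x |(T̂ V̂^{π0}) x − V̂^{π0} x|. Let π⋆ be a policy maximizing the true return ρ(·, P⋆, r), and let π_B be a (baseline) policy with ρ(π0, P̂, r̂) > ρ(π_B, P⋆, r). Then ρ(π⋆, P⋆, r) − ρ(π0, P⋆, r) ≤ min{ BR(π0)/(1−γ) + sSup { (2·γ·Rmax/(1−γ)²) · ∑_x u^π_{P̂} x · e_π x : π a policy } , ρ(π⋆, P⋆, r) − ρ(π_B, P⋆, r) }, where u^π_{P̂} x = (1−γ) · ∑_y p0 y · ((1 − γ·P̂_π)⁻¹) y x is the normalized state occupancy of π under the simulated kernel P̂ and sSup denotes the real supremum of the (nonempty,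 bounded above) set. -/

import Mathlib

open Matrix

/-- The row-stochastic matrix induced by a policy `π` from a transition kernel `P`. -/
noncomputable def polMat {X A : Type*} [Fintype A]
    (P : X → A → X → ℝ) (π : X → A → ℝ) : Matrix X X ℝ :=
  Matrix.of fun x x' => ∑ a, π x a * P x a x'

/-- The reward vector induced by a policy `π` from a reward function `r`. -/
noncomputable def polRew {X A : Type*} [Fintype A]
    (r : X → A → ℝ) (π : X → A → ℝ) : X → ℝ :=
  fun x => ∑ a, π x a * r x a

/-- The value function `V^π_{P,r} = (1 - γ • P_π)⁻¹ *ᵥ r_π`. -/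
noncomputable def valueFn {X A : Type*} [Fintype X] [DecidableEq X] [Fintype A]
    (γ : ℝ) (P : X → A → X → ℝ) (r : X → A → ℝ) (π : X → A → ℝ) : X → ℝ :=
  ((1 : Matrix X X ℝ) - γ • polMat P π)⁻¹ *ᵥ polRew r π

/-- The return `ρ(π, P, r) = ∑ x, p0 x * V^π_{P,r} x`. -/
noncomputable def ret {X A : Type*} [Fintype X] [DecidableEq X] [Fintype A]
    (p0 : X → ℝ) (γ : ℝ) (P : X → A → X → ℝ) (r : X → A → ℝ) (π : X → A → ℝ) : ℝ :=
  ∑ x, p0 x * valueFn γ P r π x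

/-- A transition kernel: nonnegative entries, each row summing to one. -/
def IsKernel {X A : Type*} [Fintype X] (P : X → A → X → ℝ) : Prop :=
  (∀ x a x', 0 ≤ P x a x') ∧ ∀ x a, ∑ x', P x a x' = 1

/-- A randomized stationary policy. -/
def IsPolicy {X A : Type*} [Fintype A] (π : X → A → ℝ) : Prop :=
  (∀ x a, 0 ≤ π x a) ∧ ∀ x, ∑ a, π x a = 1

/-- The error function `e_π x = ∑ a, π x a * e x a` induced by a policy. -/
noncomputable def polErr {X A : Type*} [Fintype A]
    (e : X → A → ℝ) (π : X → A → ℝ) : X → ℝ :=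
  fun x => ∑ a, π x a * e x a

/-- The normalized state occupancy frequency
`u^π_P x = (1 - γ) * ∑ y, p0 y * ((1 - γ • P_π)⁻¹) y x`. -/
noncomputable def occupancy {X A : Type*} [Fintype X] [DecidableEq X] [Fintype A]
    (p0 : X → ℝ) (γ : ℝ) (P : X → A → X → ℝ) (π : X → A → ℝ) : X → ℝ :=
  fun x => (1 - γ) * ∑ y, p0 y * ((1 : Matrix X X ℝ) - γ • polMat P π)⁻¹ y x

/-- The optimal Bellman operator `(T V) x = max_a (r x a + γ ∑_{x'} P x a x' * V x')`. -/
noncomputable def bellmanOp {X A : Type*} [Fintype X] [Fintype A] [Nonempty A]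
    (γ : ℝ) (P : X → A → X → ℝ) (r : X → A → ℝ) (V : X → ℝ) : X → ℝ :=
  fun x => (Finset.univ : Finset A).sup' Finset.univ_nonempty
    (fun a => r x a + γ * ∑ x', P x a x' * V x')

theorem polMat_nonneg {X A : Type*} [Fintype X] [Fintype A]
    {P : X → A → X → ℝ} (hP : IsKernel P) {π : X → A → ℝ} (hπ : IsPolicy π) (x x' : X) :
    0 ≤ polMat P π x x' := by
  simp only [polMat, Matrix.of_apply]
  exact Finset.sum_nonneg fun a _ => mul_nonneg (hπ.1 x a) (hP.1 x a x')

theorem polMat_mul_sum {X A : Type*} [Fintype X] [Fintype A]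
    (P : X → A → X → ℝ) (π : X → A → ℝ) (v : X → ℝ) (x : X) :
    ∑ x', polMat P π x x' * v x' = ∑ a, π x a * ∑ x', P x a x' * v x' := by
  simp only [polMat, Matrix.of_apply, Finset.sum_mul, Finset.mul_sum]
  rw [Finset.sum_comm]
  simp only [mul_assoc]

theorem polMat_row {X A : Type*} [Fintype X] [Fintype A]
    {P : X → A → X → ℝ} (hP : IsKernel P) {π : X → A → ℝ} (hπ : IsPolicy π) (x : X) :
    ∑ x', polMat P π x x' = 1 := by
  have h := polMat_mul_sum P π (fun _ => 1) x
  simp only [mul_one] at h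
  rw [h]
  simp [hP.2, hπ.2]

theorem resolvent_mono {X A : Type*} [Fintype X] [Fintype A]
    {γ : ℝ} (hγ0 : 0 ≤ γ) (hγ1 : γ < 1)
    {P : X → A → X → ℝ} (hP : IsKernel P) {π : X → A → ℝ} (hπ : IsPolicy π) (v : X → ℝ)
    (hv : ∀ x, γ * ∑ x', polMat P π x x' * v x' ≤ v x) (x : X) : 0 ≤ v x := by
  haveI : Nonempty X := ⟨x⟩
  obtain ⟨m, hm⟩ := Finite.exists_min v
  have h1 : v m ≤ ∑ x', polMat P π m x' * v x' := by
    calc v m = ∑ x', polMat P π m x' * v m := by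
          rw [← Finset.sum_mul, polMat_row hP hπ, one_mul]
      _ ≤ _ := Finset.sum_le_sum fun x' _ =>
          mul_le_mul_of_nonneg_left (hm x') (polMat_nonneg hP hπ m x')
  have h2 := hv m
  have h3 : γ * v m ≤ v m := (mul_le_mul_of_nonneg_left h1 hγ0).trans h2
  have h4 : 0 ≤ v m := by
    by_contra hneg
    nlinarith
  exact h4.trans (hm x)

theorem resolvent_apply {X A : Type*} [Fintype X] [DecidableEq X] [Fintype A]
    (γ : ℝ) (P : X → A → X → ℝ) (π : X → A → ℝ) (v : X → ℝ) (x : X) :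
    (((1 : Matrix X X ℝ) - γ • polMat P π) *ᵥ v) x
      = v x - γ * ∑ x', polMat P π x x' * v x' := by
  rw [Matrix.sub_mulVec, Matrix.one_mulVec, Matrix.smul_mulVec]
  simp [Matrix.mulVec, dotProduct]

theorem resolvent_isUnit {X A : Type*} [Fintype X] [DecidableEq X] [Fintype A]
    {γ : ℝ} (hγ0 : 0 ≤ γ) (hγ1 : γ < 1)
    {P : X → A → X → ℝ} (hP : IsKernel P) {π : X → A → ℝ} (hπ : IsPolicy π) :
    IsUnit ((1 : Matrix X X ℝ) - γ • polMat P π) := by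
  rw [← Matrix.mulVec_injective_iff_isUnit]
  have key : ∀ v w : X → ℝ, ((1 : Matrix X X ℝ) - γ • polMat P π) *ᵥ v
      = ((1 : Matrix X X ℝ) - γ • polMat P π) *ᵥ w → ∀ x, 0 ≤ v x - w x := by
    intro v w h x
    refine resolvent_mono hγ0 hγ1 hP hπ (fun x => v x - w x) (fun y => ?_) x
    have := congrFun h y
    rw [resolvent_apply, resolvent_apply] at this
    simp only [mul_sub, Finset.sum_sub_distrib]
    linarith
  intro v w h
  ext x
  have h1 := key v w h x
  have h2 := key w v h.symm x
  linarith

theorem valueFn_eq {X A : Type*} [Fintype X] [DecidableEq X] [Fintype A]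
    {γ : ℝ} (hγ0 : 0 ≤ γ) (hγ1 : γ < 1)
    {P : X → A → X → ℝ} (hP : IsKernel P) {π : X → A → ℝ} (hπ : IsPolicy π)
    (r : X → A → ℝ) (x : X) :
    valueFn γ P r π x - γ * ∑ x', polMat P π x x' * valueFn γ P r π x' = polRew r π x := by
  rw [← resolvent_apply, valueFn, Matrix.mulVec_mulVec, Matrix.mul_nonsing_inv, Matrix.one_mulVec]
  exact (Matrix.isUnit_iff_isUnit_det _).1 (resolvent_isUnit hγ0 hγ1 hP hπ)

theorem valueFn_le {X A : Type*} [Fintype X] [DecidableEq X] [Fintype A]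
    {γ : ℝ} (hγ0 : 0 ≤ γ) (hγ1 : γ < 1)
    {P : X → A → X → ℝ} (hP : IsKernel P) {π : X → A → ℝ} (hπ : IsPolicy π)
    (r : X → A → ℝ) (K : ℝ) (hK : ∀ x a, r x a ≤ K) (x : X) :
    valueFn γ P r π x ≤ K / (1 - γ) := by
  have h := resolvent_mono hγ0 hγ1 hP hπ (fun x => K / (1 - γ) - valueFn γ P r π x) (fun y => ?_) x
  · simpa using h
  have h1 := valueFn_eq hγ0 hγ1 hP hπ r y
  have h2 : polRew r π y ≤ K := by
    calc polRew r π y ≤ ∑ a, π y a * K :=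
          Finset.sum_le_sum fun a _ => mul_le_mul_of_nonneg_left (hK y a) (hπ.1 y a)
      _ = K := by rw [← Finset.sum_mul, hπ.2, one_mul]
  simp only [mul_sub, Finset.sum_sub_distrib]
  rw [← Finset.sum_mul, polMat_row hP hπ, one_mul]
  have h3 : K / (1 - γ) - γ * (K / (1 - γ)) = K := by
    have : 1 - γ ≠ 0 := by linarith
    field_simp
  linarith

theorem valueFn_ge {X A : Type*} [Fintype X] [DecidableEq X] [Fintype A]
    {γ : ℝ} (hγ0 : 0 ≤ γ) (hγ1 : γ < 1)
    {P : X → A → X → ℝ} (hP : IsKernel P) {π : X → A → ℝ} (hπ : IsPolicy π)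
    (r : X → A → ℝ) (K : ℝ) (hK : ∀ x a, -K ≤ r x a) (x : X) :
    -(K / (1 - γ)) ≤ valueFn γ P r π x := by
  have h := valueFn_le hγ0 hγ1 hP hπ (fun x a => - r x a) K
    (fun x a => by linarith [hK x a]) x
  have h2 : valueFn γ P (fun x a => - r x a) π x = - valueFn γ P r π x := by
    have : polRew (fun x a => - r x a) π = - polRew r π := by
      ext y; simp [polRew]
    rw [valueFn, this, Matrix.mulVec_neg]; rfl
  linarith

theorem occupancy_sum {X A : Type*} [Fintype X] [DecidableEq X] [Fintype A]
    (p0 : X → ℝ) (γ : ℝ) (P : X → A → X → ℝ) (e π : X → A → ℝ) :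
    ∑ x, occupancy p0 γ P π x * polErr e π x = (1 - γ) * ret p0 γ P e π := by
  simp only [occupancy, ret, valueFn, Matrix.mulVec, dotProduct, Finset.mul_sum, Finset.sum_mul]
  rw [Finset.sum_comm]
  refine Finset.sum_congr rfl fun y _ => Finset.sum_congr rfl fun x _ => ?_
  simp only [polErr, polRew]
  ring

/-- Two-sided comparison of the true and the reward-adjusted simulated value functions. -/
theorem value_compare {X A : Type*} [Fintype X] [DecidableEq X] [Fintype A]
    {γ : ℝ} (hγ0 : 0 ≤ γ) (hγ1 : γ < 1) {Rmax : ℝ}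
    {r : X → A → ℝ} (hr : ∀ x a, |r x a| ≤ Rmax)
    {Pstar Phat : X → A → X → ℝ} (hPstar : IsKernel Pstar) (hPhat : IsKernel Phat)
    {e : X → A → ℝ} (hR : 0 ≤ Rmax)
    (hAsm : ∀ x a, ∑ x', |Pstar x a x' - Phat x a x'| ≤ e x a)
    {rhat : X → A → ℝ}
    (hrhat : ∀ x a, rhat x a = r x a - γ * Rmax / (1 - γ) * e x a)
    {π : X → A → ℝ} (hπ : IsPolicy π) (x : X) :
    valueFn γ Phat rhat π x ≤ valueFn γ Pstar r π x ∧
    valueFn γ Pstar r π x ≤ valueFn γ Phat rhat π x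
      + 2 * (γ * Rmax / (1 - γ)) * valueFn γ Phat e π x := by
  set c := γ * Rmax / (1 - γ) with hc
  set V := valueFn γ Pstar r π with hV
  have hVb : ∀ y, |V y| ≤ Rmax / (1 - γ) := fun y => abs_le.2
    ⟨valueFn_ge hγ0 hγ1 hPstar hπ r Rmax (fun x a => (abs_le.1 (hr x a)).1) y,
     valueFn_le hγ0 hγ1 hPstar hπ r Rmax (fun x a => (abs_le.1 (hr x a)).2) y⟩
  have hB : 0 ≤ Rmax / (1 - γ) := div_nonneg hR (by linarith)
  have hd : ∀ y a, |γ * (∑ x', Pstar y a x' * V x' - ∑ x', Phat y a x' * V x')| ≤ c * e y a := by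
    intro y a
    rw [← Finset.sum_sub_distrib, abs_mul, abs_of_nonneg hγ0, hc, mul_div_assoc, mul_assoc]
    refine mul_le_mul_of_nonneg_left ?_ hγ0
    calc |∑ x', (Pstar y a x' * V x' - Phat y a x' * V x')|
        ≤ ∑ x', |Pstar y a x' * V x' - Phat y a x' * V x'| := Finset.abs_sum_le_sum_abs _ _
      _ ≤ ∑ x', |Pstar y a x' - Phat y a x'| * (Rmax / (1 - γ)) := by
          refine Finset.sum_le_sum fun x' _ => ?_
          rw [← sub_mul, abs_mul]
          exact mul_le_mul_of_nonneg_left (hVb x') (abs_nonneg _)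
      _ ≤ e y a * (Rmax / (1 - γ)) := by
          rw [← Finset.sum_mul]
          exact mul_le_mul_of_nonneg_right (hAsm y a) hB
      _ = _ := mul_comm _ _
  have hd2 : ∀ y, |γ * ∑ x', polMat Pstar π y x' * V x' - γ * ∑ x', polMat Phat π y x' * V x'|
      ≤ c * polRew e π y := by
    intro y
    rw [polMat_mul_sum, polMat_mul_sum]
    calc _ = |∑ a, π y a * (γ * (∑ x', Pstar y a x' * V x' - ∑ x', Phat y a x' * V x'))| := by
          congr 1
          rw [← mul_sub, ← Finset.sum_sub_distrib, Finset.mul_sum]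
          refine Finset.sum_congr rfl fun a _ => ?_
          ring
      _ ≤ ∑ a, |π y a * (γ * (∑ x', Pstar y a x' * V x' - ∑ x', Phat y a x' * V x'))| :=
          Finset.abs_sum_le_sum_abs _ _
      _ ≤ ∑ a, π y a * (c * e y a) := by
          refine Finset.sum_le_sum fun a _ => ?_
          rw [abs_mul, abs_of_nonneg (hπ.1 y a)]
          exact mul_le_mul_of_nonneg_left (hd y a) (hπ.1 y a)
      _ = c * polRew e π y := by
          rw [polRew, Finset.mul_sum]
          refine Finset.sum_congr rfl fun a _ => ?_
          ring
  have hrp : ∀ y, polRew rhat π y = polRew r π y - c * polRew e π y := by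
    intro y
    simp only [polRew, Finset.mul_sum, ← Finset.sum_sub_distrib]
    refine Finset.sum_congr rfl fun a _ => ?_
    rw [hrhat]; ring
  have e1 := valueFn_eq hγ0 hγ1 hPstar hπ r
  have e2 := valueFn_eq hγ0 hγ1 hPhat hπ rhat
  have e3 := valueFn_eq hγ0 hγ1 hPhat hπ e
  rw [← hV] at e1
  constructor
  · have := resolvent_mono hγ0 hγ1 hPhat hπ (fun y => V y - valueFn γ Phat rhat π y)
      (fun y => ?_) x
    · simpa using this
    · simp only [mul_sub, Finset.sum_sub_distrib]
      linarith [e1 y, e2 y, hrp y, (abs_le.1 (hd2 y)).1]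
  · have := resolvent_mono hγ0 hγ1 hPhat hπ
      (fun y => valueFn γ Phat rhat π y + 2 * c * valueFn γ Phat e π y - V y)
      (fun y => ?_) x
    · linarith
    · have h5 : ∑ x', polMat Phat π y x' * (2 * c * valueFn γ Phat e π x')
          = 2 * c * ∑ x', polMat Phat π y x' * valueFn γ Phat e π x' := by
        rw [Finset.mul_sum]
        refine Finset.sum_congr rfl fun a _ => ?_
        ring
      have h6 : 2 * c * (valueFn γ Phat e π y
          - γ * ∑ x', polMat Phat π y x' * valueFn γ Phat e π x') = 2 * c * polRew e π y := by
        rw [e3 y]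
      simp only [mul_sub, mul_add, Finset.sum_sub_distrib, Finset.sum_add_distrib]
      rw [h5]
      linarith [e1 y, e2 y, hrp y, (abs_le.1 (hd2 y)).2]

/-- Corollary 6: alternative performance-loss bound for the
reward-adjusted solution in terms of its Bellman residual. -/
theorem reward_adjusted_alt_perf_loss
    {X A : Type*} [Fintype X] [Nonempty X] [DecidableEq X] [Fintype A] [Nonempty A]
    (γ : ℝ) (hγ0 : 0 ≤ γ) (hγ1 : γ < 1)
    (Rmax : ℝ) (hR : 0 ≤ Rmax)
    (r : X → A → ℝ) (hr : ∀ x a, |r x a| ≤ Rmax)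
    (p0 : X → ℝ) (hp0 : ∀ x, 0 ≤ p0 x) (hp1 : ∑ x, p0 x = 1)
    (Pstar Phat : X → A → X → ℝ) (hPstar : IsKernel Pstar) (hPhat : IsKernel Phat)
    (e : X → A → ℝ)
    (hAsm : ∀ x a, ∑ x', |Pstar x a x' - Phat x a x'| ≤ e x a)
    (rhat : X → A → ℝ)
    (hrhat : ∀ x a, rhat x a = r x a - γ * Rmax / (1 - γ) * e x a)
    (π0 : X → A → ℝ) (hπ0 : IsPolicy π0)
    (hπ0opt : ∀ π : X → A → ℝ, IsPolicy π → ret p0 γ Phat rhat π ≤ ret p0 γ Phat rhat π0)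
    (Vhatπ0 : X → ℝ) (hVhatπ0 : Vhatπ0 = valueFn γ Phat rhat π0)
    (BR : ℝ)
    (hBR : BR = (Finset.univ : Finset X).sup' Finset.univ_nonempty
      (fun x => |bellmanOp γ Phat rhat Vhatπ0 x - Vhatπ0 x|))
    (πstar : X → A → ℝ) (hπstar : IsPolicy πstar)
    (hπstaropt : ∀ π : X → A → ℝ, IsPolicy π → ret p0 γ Pstar r π ≤ ret p0 γ Pstar r πstar)
    (πB : X → A → ℝ) (hπB : IsPolicy πB)
    (hcond : ret p0 γ Phat rhat π0 > ret p0 γ Pstar r πB) :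
    ret p0 γ Pstar r πstar - ret p0 γ Pstar r π0 ≤
      min (BR / (1 - γ) +
          sSup {v : ℝ | ∃ π : X → A → ℝ, IsPolicy π ∧
            v = 2 * γ * Rmax / (1 - γ) ^ 2 *
              ∑ x, occupancy p0 γ Phat π x * polErr e π x})
        (ret p0 γ Pstar r πstar - ret p0 γ Pstar r πB) := by
  have hg : 0 < 1 - γ := by linarith
  have hlow : ret p0 γ Phat rhat π0 ≤ ret p0 γ Pstar r π0 :=
    Finset.sum_le_sum fun x _ => mul_le_mul_of_nonneg_left
      (value_compare hγ0 hγ1 hr hPstar hPhat hR hAsm hrhat hπ0 x).1 (hp0 x)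
  refine le_min ?_ (by linarith)
  have hup : ret p0 γ Pstar r πstar ≤ ret p0 γ Phat rhat πstar
      + 2 * (γ * Rmax / (1 - γ)) * ret p0 γ Phat e πstar := by
    simp only [ret, Finset.mul_sum, ← Finset.sum_add_distrib]
    refine Finset.sum_le_sum fun x _ => ?_
    have := mul_le_mul_of_nonneg_left
      (value_compare hγ0 hγ1 hr hPstar hPhat hR hAsm hrhat hπstar x).2 (hp0 x)
    linarith
  have hval : ∀ π : X → A → ℝ, 2 * γ * Rmax / (1 - γ) ^ 2 *
      ∑ x, occupancy p0 γ Phat π x * polErr e π x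
      = 2 * (γ * Rmax / (1 - γ)) * ret p0 γ Phat e π := by
    intro π
    rw [occupancy_sum]
    field_simp
  have hBR0 : 0 ≤ BR := by
    obtain ⟨x⟩ := ‹Nonempty X›
    rw [hBR]
    exact (abs_nonneg _).trans (Finset.le_sup' (fun x => |bellmanOp γ Phat rhat Vhatπ0 x - Vhatπ0 x|)
      (Finset.mem_univ x))
  have hS : 2 * (γ * Rmax / (1 - γ)) * ret p0 γ Phat e πstar ≤
      sSup {v : ℝ | ∃ π : X → A → ℝ, IsPolicy π ∧
            v = 2 * γ * Rmax / (1 - γ) ^ 2 *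
              ∑ x, occupancy p0 γ Phat π x * polErr e π x} := by
    refine le_csSup ?_ ⟨πstar, hπstar, (hval _).symm⟩
    obtain ⟨p, hp⟩ := Finite.exists_max (fun p : X × A => e p.1 p.2)
    refine ⟨2 * (γ * Rmax / (1 - γ)) * (e p.1 p.2 / (1 - γ)), ?_⟩
    rintro v ⟨π, hπ, rfl⟩
    rw [hval]
    refine mul_le_mul_of_nonneg_left ?_ (by positivity)
    calc ret p0 γ Phat e π ≤ ∑ x, p0 x * (e p.1 p.2 / (1 - γ)) :=
          Finset.sum_le_sum fun x _ => mul_le_mul_of_nonneg_left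
            (valueFn_le hγ0 hγ1 hPhat hπ e _ (fun x a => hp (x, a)) x) (hp0 x)
      _ = _ := by rw [← Finset.sum_mul, hp1, one_mul]
  have h1 := hπ0opt πstar hπstar
  have h2 : 0 ≤ BR / (1 - γ) := div_nonneg hBR0 hg.le
  linarith
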